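/- arXiv:1703.07499 — 10 statements merged into one kernel-verified Lean document; each statement's English description precedes it below -/
import Mathlib

section
/- For every rationality parameter α with 0 < α < 1, the Prelec probability weighting function w_α has an S-shape with inflection point at p = 1/e: w_α is strictly concave on the interval (0, 1/e] and strictly convex on the interval [1/e, 1]. -/
/-- The Prelec probability weighting function with rationality parameter `α`:
`w_α(p) = exp(−(−ln p)^α)` for `p ∈ (0,1]`, extended by `w_α(0) = 0`. -/
noncomputable def prelec (α p : ℝ) : ℝ :=
  if p = 0 then 0 else Real.exp (-(-Real.log p) ^ α)

theorem hasDerivAt_neg_log_rpow (β : ℝ) {p : ℝ} (hp : 0 < p) (hp1 : p < 1) :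
    HasDerivAt (fun x => (-Real.log x) ^ β) (-(β * (-Real.log p) ^ (β - 1) * p⁻¹)) p := by
  have ht : 0 < -Real.log p := neg_pos.2 (Real.log_neg hp hp1)
  convert (Real.hasDerivAt_log hp.ne').fun_neg.rpow_const (p := β) (Or.inl ht.ne') using 1
  ring

theorem hasDerivAt_exp_neg_neg_log_rpow (α : ℝ) {p : ℝ} (hp : 0 < p) (hp1 : p < 1) :
    HasDerivAt (fun x => Real.exp (-(-Real.log x) ^ α))
      (α * (-Real.log p) ^ (α - 1) * p⁻¹ * Real.exp (-(-Real.log p) ^ α)) p := by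
  convert (hasDerivAt_neg_log_rpow α hp hp1).fun_neg.exp using 1
  ring

theorem hasDerivAt_prelec (α : ℝ) {p : ℝ} (hp : 0 < p) (hp1 : p < 1) :
    HasDerivAt (prelec α)
      (α * (-Real.log p) ^ (α - 1) * p⁻¹ * Real.exp (-(-Real.log p) ^ α)) p := by
  refine (hasDerivAt_exp_neg_neg_log_rpow α hp hp1).congr_of_eventuallyEq ?_
  filter_upwards [eventually_ne_nhds hp.ne'] with x hx
  simp [prelec, hx]

theorem deriv2_prelec (α : ℝ) {p : ℝ} (hp : 0 < p) (hp1 : p < 1) :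
    deriv^[2] (prelec α) p =
      α * (-Real.log p) ^ (α - 1) * Real.exp (-(-Real.log p) ^ α) * (p⁻¹) ^ 2 * (-Real.log p)⁻¹ *
        -(α - 1 - α * (-Real.log p) ^ α + -Real.log p) := by
  have ht : 0 < -Real.log p := neg_pos.2 (Real.log_neg hp hp1)
  have heq : deriv (prelec α) =ᶠ[nhds p] fun x =>
      α * (-Real.log x) ^ (α - 1) * x⁻¹ * Real.exp (-(-Real.log x) ^ α) := by
    filter_upwards [Ioo_mem_nhds hp hp1] with x hx
    exact (hasDerivAt_prelec α hx.1 hx.2).deriv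
  have hd := (((hasDerivAt_neg_log_rpow (α - 1) hp hp1).const_mul α).fun_mul
    (hasDerivAt_inv hp.ne')).fun_mul (hasDerivAt_exp_neg_neg_log_rpow α hp hp1)
  simp only [Function.iterate_succ, Function.iterate_zero, Function.comp_apply, id]
  rw [heq.deriv_eq, hd.deriv, Real.rpow_sub_one ht.ne' (α - 1), Real.rpow_sub_one ht.ne' α]
  field_simp
  ring

theorem continuousOn_prelec {α : ℝ} (hα : 0 < α) : ContinuousOn (prelec α) (Set.Ioi 0) := by
  have h : ContinuousOn (fun p => Real.exp (-(-Real.log p) ^ α)) (Set.Ioi 0) := by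
    refine Real.continuous_exp.comp_continuousOn (ContinuousOn.neg ?_)
    exact (Real.continuousOn_log.mono fun x hx => (Set.mem_Ioi.1 hx).ne').neg.rpow_const
      fun _ _ => Or.inr hα.le
  refine h.congr fun p hp => ?_
  simp [prelec, (Set.mem_Ioi.1 hp).ne']

theorem sub_mul_rpow_add_pos {α t : ℝ} (hα : 0 < α) (hα1 : α < 1) (ht : 1 < t) :
    0 < α - 1 - α * t ^ α + t := by
  have h : t ^ α ≤ 1 + α * (t - 1) := by
    simpa using rpow_one_add_le_one_add_mul_self (s := t - 1) (by linarith) hα.le hα1.le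
  nlinarith [mul_le_mul_of_nonneg_left h hα.le,
    mul_pos (mul_pos (sub_pos.2 ht) (sub_pos.2 hα1)) (by linarith : 0 < 1 + α)]

theorem sub_mul_rpow_add_neg {α t : ℝ} (hα : 0 < α) (hα1 : α < 1) (ht0 : 0 < t) (ht : t < 1) :
    α - 1 - α * t ^ α + t < 0 := by
  have h : t ≤ t ^ α := by
    simpa using Real.rpow_le_rpow_of_exponent_ge ht0 ht.le hα1.le
  nlinarith [mul_le_mul_of_nonneg_left h hα.le, mul_pos (sub_pos.2 ht) (sub_pos.2 hα1)]

/-- For every rationality parameter `α` with `0 < α < 1`, the Prelec probability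
weighting function has an S-shape with inflection point at `p = 1/e`:
it is strictly concave on `(0, 1/e]` and strictly convex on `[1/e, 1]`. -/
theorem prelec_S_shape (α : ℝ) (hα : 0 < α) (hα1 : α < 1) :
    StrictConcaveOn ℝ (Set.Ioc (0 : ℝ) (1 / Real.exp 1)) (prelec α) ∧
    StrictConvexOn ℝ (Set.Icc (1 / Real.exp 1) (1 : ℝ)) (prelec α) := by
  have he : 1 / Real.exp 1 = Real.exp (-1) := by rw [Real.exp_neg, one_div]
  have he1 : Real.exp (-1) < 1 := by simp
  rw [he]
  constructor
  · refine strictConcaveOn_of_deriv2_neg (convex_Ioc _ _)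
      ((continuousOn_prelec hα).mono fun x hx => hx.1) fun p hp => ?_
    rw [interior_Ioc] at hp
    have hlog : 1 < -Real.log p := by linarith [(Real.log_lt_iff_lt_exp hp.1).2 hp.2]
    rw [deriv2_prelec α hp.1 (hp.2.trans he1)]
    have hp0 := hp.1
    have ht : 0 < -Real.log p := by linarith
    exact mul_neg_of_pos_of_neg (by positivity) (neg_neg_of_pos (sub_mul_rpow_add_pos hα hα1 hlog))
  · refine strictConvexOn_of_deriv2_pos (convex_Icc _ _)
      ((continuousOn_prelec hα).mono fun x hx => (Real.exp_pos _).trans_le hx.1) fun p hp => ?_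
    rw [interior_Icc] at hp
    have hp0 : 0 < p := (Real.exp_pos _).trans hp.1
    have hlog : -Real.log p < 1 := by linarith [(Real.lt_log_iff_exp_lt hp0).2 hp.1]
    have ht : 0 < -Real.log p := neg_pos.2 (Real.log_neg hp0 hp.2)
    rw [deriv2_prelec α hp0 hp.2]
    exact mul_pos (by positivity) (neg_pos.2 (sub_mul_rpow_add_neg hα hα1 ht hlog))
end

section
/- Theorem 1 (convergence of fictitious play to a mixed-strategy Nash equilibrium under PT, which includes EUT as the case α = 1): consider a fictitious play process as in the context, with rationality parameters α_d, α_a ∈ (0,1]. If the empirical frequency vectors converge componentwise, σ_a^k → p_d* and σ_d^k → p_a*, then (p_d*, p_a*) is a mixed-strategy Nash equilibrium of the PT game: for every probability vector q_d on S_d, ∑_{s_d} p_d*(s_d) ∑_{s_a} w_{α_d}(p_a*(s_a)) u(s_d, s_a) ≥ ∑_{s_d} q_d(s_d) ∑_{s_a} w_{α_d}(p_a*(s_a)) u(s_d, s_a), and for every probability vector q_a on S_a, ∑_{s_a} p_a*(s_a) ∑_{s_d} w_{α_a}(p_d*(s_d)) (−u(s_d, s_a)) ≥ ∑_{s_a}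 q_a(s_a) ∑_{s_d} w_{α_a}(p_d*(s_d)) (−u(s_d, s_a)). -/
open Filter

open Topology

theorem prelec_continuousOn_Icc {α : ℝ} (hα : 0 < α) :
    ContinuousOn (prelec α) (Set.Icc 0 1) := by
  intro p hp
  rcases eq_or_lt_of_le hp.1 with rfl | hp0
  · refine ContinuousWithinAt.mono (t := Set.Ici 0) ?_ Set.Icc_subset_Ici_self
    rw [← continuousWithinAt_Ioi_iff_Ici]
    have hlim : Tendsto (fun x : ℝ => Real.exp (-(-Real.log x) ^ α)) (𝓝[>] 0) (𝓝 0) :=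
      Real.tendsto_exp_neg_atTop_nhds_zero.comp
        ((tendsto_rpow_atTop hα).comp
          (tendsto_neg_atBot_atTop.comp Real.tendsto_log_nhdsGT_zero))
    have h0 : prelec α 0 = 0 := by simp [prelec]
    rw [ContinuousWithinAt, h0]
    refine hlim.congr' ?_
    filter_upwards [self_mem_nhdsWithin] with x hx
    simp [prelec, (Set.mem_Ioi.mp hx).ne']
  · refine ContinuousAt.continuousWithinAt ?_
    have hcont : ContinuousAt (fun x : ℝ => Real.exp (-(-Real.log x) ^ α)) p :=
      (((Real.continuousAt_log hp0.ne').neg.rpow_const (Or.inr hα.le)).neg).rexp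
    refine hcont.congr ?_
    filter_upwards [lt_mem_nhds hp0] with x hx
    simp [prelec, hx.ne']

theorem empiricalFreq_mem_Icc {S : Type*} [DecidableEq S] (s : ℕ → S) (k : ℕ) (x : S) :
    (((Finset.Icc 1 k).filter (fun m => s m = x)).card : ℝ) / k ∈ Set.Icc (0 : ℝ) 1 := by
  refine ⟨by positivity, div_le_one_of_le₀ ?_ (Nat.cast_nonneg k)⟩
  exact_mod_cast (Finset.card_filter_le _ _).trans (by simp)

theorem sum_empiricalFreq {S : Type*} [Fintype S] [DecidableEq S] (s : ℕ → S) {k : ℕ}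
    (hk : 1 ≤ k) :
    ∑ x, (((Finset.Icc 1 k).filter (fun m => s m = x)).card : ℝ) / k = 1 := by
  have hcard := Finset.card_eq_sum_card_fiberwise (f := s) (s := Finset.Icc 1 k)
    (t := Finset.univ) (fun _ _ => by simp)
  rw [← Finset.sum_div, ← Nat.cast_sum, ← hcard, Nat.card_Icc, Nat.add_sub_cancel]
  exact div_self (by exact_mod_cast (by omega : k ≠ 0))

/-- A strategy whose empirical frequency has a nonzero limit is played infinitely often. -/
theorem frequently_eq_of_tendsto_empiricalFreq {S : Type*} [DecidableEq S] {s : ℕ → S} {x : S}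
    {p : ℝ} (hp : p ≠ 0)
    (h : Tendsto (fun k : ℕ => (((Finset.Icc 1 k).filter (fun m => s m = x)).card : ℝ) / k)
      atTop (𝓝 p)) :
    ∃ᶠ m in atTop, s m = x := by
  intro hev
  obtain ⟨N, hN⟩ := eventually_atTop.mp hev
  refine hp (tendsto_nhds_unique h ?_)
  refine squeeze_zero (fun k => by positivity) (fun k => ?_)
    (tendsto_const_div_atTop_nhds_zero_nat (N : ℝ))
  gcongr
  refine (Finset.card_le_card (t := Finset.range N) fun m hm => ?_).trans (by simp)
  rw [Finset.mem_range]
  by_contra hle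
  exact hN m (not_lt.mp hle) (Finset.mem_filter.mp hm).2

/-- If actions are best responses to convergent payoff vectors, then the limit of their empirical
frequencies is a best mixed response to the limit payoff vector. -/
theorem empiricalFreq_limit_isBestResponse {S : Type*} [Fintype S] [Nonempty S] [DecidableEq S]
    {s : ℕ → S} {freq : ℕ → S → ℝ} {F : ℕ → S → ℝ} {G p : S → ℝ}
    (hfreq : ∀ k ≥ 1, ∀ x : S,
      freq k x = (((Finset.Icc 1 k).filter (fun m => s m = x)).card : ℝ) / k)
    (hbr : ∀ k ≥ 1, ∀ x, F k x ≤ F k (s (k + 1)))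
    (hF : ∀ x, Tendsto (fun k => F k x) atTop (𝓝 (G x)))
    (hp : ∀ x, Tendsto (fun k => freq k x) atTop (𝓝 (p x)))
    (q : S → ℝ) (hq0 : ∀ x, 0 ≤ q x) (hq1 : ∑ x, q x = 1) :
    ∑ x, q x * G x ≤ ∑ x, p x * G x := by
  have hp1 : ∑ x, p x = 1 := by
    refine tendsto_nhds_unique (tendsto_finsetSum _ fun x _ => hp x) ?_
    refine tendsto_const_nhds.congr' ?_
    filter_upwards [eventually_ge_atTop 1] with k hk
    simp_rw [hfreq k hk]
    exact (sum_empiricalFreq s hk).symm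
  have hsupp : ∀ x, p x ≠ 0 → ∀ z, G z ≤ G x := by
    intro x hx z
    by_contra! hlt
    have hfr : ∃ᶠ m in atTop, s m = x := by
      refine frequently_eq_of_tendsto_empiricalFreq hx ((hp x).congr' ?_)
      filter_upwards [eventually_ge_atTop 1] with k hk using hfreq k hk x
    obtain ⟨N, hN⟩ := eventually_atTop.mp ((hF x).eventually_lt (hF z) hlt)
    obtain ⟨m, hm, hsm⟩ := frequently_atTop.mp hfr (N + 2)
    obtain ⟨k, rfl⟩ : ∃ k, m = k + 1 := ⟨m - 1, by omega⟩
    have hle := hbr k (by omega) z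
    rw [hsm] at hle
    exact absurd (hN k (by omega)) (not_lt.mpr hle)
  obtain ⟨z, hz⟩ := Finite.exists_max G
  calc ∑ x, q x * G x ≤ ∑ x, q x * G z :=
        Finset.sum_le_sum fun x _ => mul_le_mul_of_nonneg_left (hz x) (hq0 x)
    _ = ∑ x, p x * G z := by rw [← Finset.sum_mul, ← Finset.sum_mul, hq1, hp1]
    _ = ∑ x, p x * G x := by
        refine Finset.sum_congr rfl fun x _ => ?_
        by_cases hx : p x = 0
        · simp [hx]
        · rw [le_antisymm (hsupp x hx z) (hz x)]

theorem tendsto_sum_prelec_mul {S : Type*} [Fintype S] [DecidableEq S] {α : ℝ} (hα : 0 < α)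
    {s : ℕ → S} {freq : ℕ → S → ℝ} {p : S → ℝ}
    (hfreq : ∀ k ≥ 1, ∀ x : S,
      freq k x = (((Finset.Icc 1 k).filter (fun m => s m = x)).card : ℝ) / k)
    (hp : ∀ x, Tendsto (fun k => freq k x) atTop (𝓝 (p x))) (v : S → ℝ) :
    Tendsto (fun k => ∑ x, prelec α (freq k x) * v x) atTop (𝓝 (∑ x, prelec α (p x) * v x)) := by
  refine tendsto_finsetSum _ fun x _ => Tendsto.mul_const _ ?_
  have hmem : ∀ᶠ k in atTop, freq k x ∈ Set.Icc (0 : ℝ) 1 := by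
    filter_upwards [eventually_ge_atTop 1] with k hk
    rw [hfreq k hk]
    exact empiricalFreq_mem_Icc s k x
  exact (prelec_continuousOn_Icc hα (p x) (isClosed_Icc.mem_of_tendsto (hp x) hmem)).tendsto.comp
    (tendsto_nhdsWithin_iff.mpr ⟨hp x, hmem⟩)

/-- Theorem 1 (convergence of fictitious play to a mixed-strategy Nash equilibrium under
PT; the EUT case corresponds to `α = 1`). In a finite two-player zero-sum game with
defender strategy set `Sd`, attacker strategy set `Sa` and defender payoff `u`
(the attacker receives `−u`), consider a fictitious play process: at each step `k ≥ 1`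
the empirical frequencies `σd k` (of the attacker's past actions) and `σa k` (of the
defender's past actions) are formed, and the next actions `sd (k+1)`, `sa (k+1)` are
best responses to the Prelec-weighted empirical frequencies. If the empirical
frequencies converge componentwise, `σa k → pd*` and `σd k → pa*`, then `(pd*, pa*)` is
a mixed-strategy Nash equilibrium of the PT game. -/
theorem fictitiousPlay_converges_to_PT_MSNE
    {Sd Sa : Type*} [Fintype Sd] [Fintype Sa] [Nonempty Sd] [Nonempty Sa]
    [DecidableEq Sd] [DecidableEq Sa]
    (u : Sd → Sa → ℝ) (αd αa : ℝ)
    (hαd : αd ∈ Set.Ioc (0 : ℝ) 1) (hαa : αa ∈ Set.Ioc (0 : ℝ) 1)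
    (sd : ℕ → Sd) (sa : ℕ → Sa) (σd : ℕ → Sa → ℝ) (σa : ℕ → Sd → ℝ)
    -- empirical frequencies of the opponent's past actions
    (hσd : ∀ k ≥ 1, ∀ y : Sa,
      σd k y = (((Finset.Icc 1 k).filter (fun m => sa m = y)).card : ℝ) / k)
    (hσa : ∀ k ≥ 1, ∀ x : Sd,
      σa k x = (((Finset.Icc 1 k).filter (fun m => sd m = x)).card : ℝ) / k)
    -- each next action maximizes the PT expected utility against the weighted frequencies
    (hbrd : ∀ k ≥ 1, ∀ x : Sd,
      ∑ y, prelec αd (σd k y) * u x y ≤ ∑ y, prelec αd (σd k y) * u (sd (k + 1)) y)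
    (hbra : ∀ k ≥ 1, ∀ y : Sa,
      ∑ x, prelec αa (σa k x) * (-u x y) ≤ ∑ x, prelec αa (σa k x) * (-u x (sa (k + 1))))
    -- convergence of the empirical frequencies
    (pd : Sd → ℝ) (pa : Sa → ℝ)
    (hconva : ∀ x : Sd, Tendsto (fun k => σa k x) atTop (nhds (pd x)))
    (hconvd : ∀ y : Sa, Tendsto (fun k => σd k y) atTop (nhds (pa y))) :
    -- (pd, pa) is a mixed-strategy Nash equilibrium of the PT game
    (∀ qd : Sd → ℝ, (∀ x, 0 ≤ qd x) → (∑ x, qd x = 1) →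
      ∑ x, qd x * ∑ y, prelec αd (pa y) * u x y ≤
        ∑ x, pd x * ∑ y, prelec αd (pa y) * u x y) ∧
    (∀ qa : Sa → ℝ, (∀ y, 0 ≤ qa y) → (∑ y, qa y = 1) →
      ∑ y, qa y * ∑ x, prelec αa (pd x) * (-u x y) ≤
        ∑ y, pa y * ∑ x, prelec αa (pd x) * (-u x y)) := by
  exact ⟨empiricalFreq_limit_isBestResponse hσa hbrd
      (fun x => tendsto_sum_prelec_mul hαd.1 hσd hconvd (u x)) hconva,
    empiricalFreq_limit_isBestResponse hσd hbra
      (fun y => tendsto_sum_prelec_mul hαa.1 hσa hconva (fun x => -u x y)) hconvd⟩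
end

section
/- Theorem 2, attacker-side uniqueness: for every fine F > 0, there exists exactly one pair (p, v) ∈ ℝ⁴ × ℝ such that p₁ + p₂ + p₃ + p₄ = 1 and M_a(F)·p = v·𝟙₆ (all six entries of M_a(F)·p equal v); moreover this unique p has all four entries strictly positive, so it is a valid mixed strategy of the attacker. -/
/-- The defender's payoff matrix `M_a(F)` of the hardware trojan detection case study:
rows indexed by the defender's tested pairs `(AB, AC, AD, BC, BD, CD)`, columns by the
attacker's inserted trojan `(A, B, C, D)` with damages `(1, 2, 4, 12)`; the entry is the
fine `F` if the inserted trojan belongs to the tested pair and `−V_t` otherwise. -/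
noncomputable def Ma (F : ℝ) : Matrix (Fin 6) (Fin 4) ℝ :=
  !![F,  F,  -4, -12;
     F,  -2, F,  -12;
     F,  -2, -4, F;
     -1, F,  F,  -12;
     -1, F,  -4, F;
     -1, -2, F,  F]

/-- The attacker's payoff matrix `M_d(F) = −M_a(F)ᵀ`. -/
noncomputable def Md (F : ℝ) : Matrix (Fin 4) (Fin 6) ℝ := -((Ma F).transpose)

/-- The system `∑ p = 1`, `Ma F · p = v 𝟙` says that the products `(F + V_t) p_t` all equal a
common constant `c`. -/
theorem Ma_equalizing_iff (F : ℝ) (p : Fin 4 → ℝ) (v : ℝ) :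
    ((∑ j, p j = 1) ∧ ∀ i : Fin 6, (Ma F).mulVec p i = v) ↔
      (∑ j, p j = 1) ∧ ∃ c, (F + 1) * p 0 = c ∧ (F + 2) * p 1 = c ∧ (F + 4) * p 2 = c ∧
        (F + 12) * p 3 = c ∧ v = 2 * c - (p 0 + 2 * p 1 + 4 * p 2 + 12 * p 3) := by
  refine and_congr_right fun _ => ?_
  simp [Fin.forall_fin_succ, Ma, Matrix.mulVec, dotProduct, Fin.sum_univ_four]
  constructor
  · rintro ⟨h0, h1, h2, h3, h4, h5⟩
    refine ⟨?_, ?_, ?_, ?_⟩ <;> linarith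
  · rintro ⟨h1, h2, h3, hv⟩
    refine ⟨?_, ?_, ?_, ?_, ?_, ?_⟩ <;> linarith

/-- The system `∑ p = 1`, `Ma F · p = v 𝟙` has an explicit solution, and no other one. -/
theorem Ma_equalizing_iff_eq {F : ℝ} (hF : 0 < F) (p : Fin 4 → ℝ) (v : ℝ) :
    ((∑ j, p j = 1) ∧ ∀ i : Fin 6, (Ma F).mulVec p i = v) ↔
      ∃ c, c = (1 / (F + 1) + 1 / (F + 2) + 1 / (F + 4) + 1 / (F + 12))⁻¹ ∧
        p = ![c / (F + 1), c / (F + 2), c / (F + 4), c / (F + 12)] ∧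
        v = 2 * c - (p 0 + 2 * p 1 + 4 * p 2 + 12 * p 3) := by
  rw [Ma_equalizing_iff, Fin.sum_univ_four]
  have h1 : F + 1 ≠ 0 := by positivity
  have h2 : F + 2 ≠ 0 := by positivity
  have h4 : F + 4 ≠ 0 := by positivity
  have h12 : F + 12 ≠ 0 := by positivity
  have hS : 1 / (F + 1) + 1 / (F + 2) + 1 / (F + 4) + 1 / (F + 12) ≠ 0 := by positivity
  constructor
  · rintro ⟨hs, c, e0, e1, e2, e3, hv⟩
    have f0 : p 0 = c / (F + 1) := by rw [eq_div_iff h1]; linarith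
    have f1 : p 1 = c / (F + 2) := by rw [eq_div_iff h2]; linarith
    have f2 : p 2 = c / (F + 4) := by rw [eq_div_iff h4]; linarith
    have f3 : p 3 = c / (F + 12) := by rw [eq_div_iff h12]; linarith
    refine ⟨c, ?_, ?_, hv⟩
    · apply eq_inv_of_mul_eq_one_left
      rw [f0, f1, f2, f3] at hs
      linear_combination hs
    · ext j
      fin_cases j <;> simpa
  · rintro ⟨c, hc, rfl, hv⟩
    refine ⟨?_, c, ?_, ?_, ?_, ?_, hv⟩
    · have := inv_mul_cancel₀ hS
      rw [← hc] at this
      simp only [Matrix.cons_val]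
      linear_combination this
    all_goals
      simp only [Matrix.cons_val]
      field_simp

/-- Theorem 2, attacker-side uniqueness: for every fine `F > 0`, there exists exactly
one pair `(p, v) ∈ ℝ⁴ × ℝ` such that `p₁ + p₂ + p₃ + p₄ = 1` and `M_a(F)·p = v·𝟙₆`
(all six entries of `M_a(F)·p` equal `v`); moreover this unique `p` has all four
entries strictly positive, so it is a valid mixed strategy of the attacker. -/
theorem attacker_equilibrium_unique (F : ℝ) (hF : 0 < F) :
    (∃! pv : (Fin 4 → ℝ) × ℝ,
      (∑ j, pv.1 j = 1) ∧ ∀ i : Fin 6, (Ma F).mulVec pv.1 i = pv.2) ∧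
    (∀ pv : (Fin 4 → ℝ) × ℝ,
      ((∑ j, pv.1 j = 1) ∧ ∀ i : Fin 6, (Ma F).mulVec pv.1 i = pv.2) →
      ∀ j : Fin 4, 0 < pv.1 j) := by
  simp only [Ma_equalizing_iff_eq hF]
  constructor
  · let c := (1 / (F + 1) + 1 / (F + 2) + 1 / (F + 4) + 1 / (F + 12))⁻¹
    let p := ![c / (F + 1), c / (F + 2), c / (F + 4), c / (F + 12)]
    refine ⟨(p, 2 * c - (p 0 + 2 * p 1 + 4 * p 2 + 12 * p 3)), ⟨c, rfl, rfl, rfl⟩, ?_⟩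
    rintro ⟨p, v⟩ ⟨c, rfl, rfl, hv⟩
    exact Prod.ext rfl hv
  · rintro ⟨p, v⟩ ⟨c, rfl, rfl, -⟩ j
    fin_cases j <;> simp only [Fin.mk_one, Fin.zero_eta, Fin.reduceFinMk, Matrix.cons_val] <;>
      positivity
end

section
/- Explicit attacker equilibrium formula: for every fine F > 0, set n(F) = ((F+4)/(F+1), (F+4)/(F+2), 1, (F+4)/(F+12)) ∈ ℝ⁴ and N(F) = (F+4)/(F+1) + (F+4)/(F+2) + 1 + (F+4)/(F+12). Then the vector p(F) = n(F)/N(F) satisfies p(F)₁ + p(F)₂ + p(F)₃ + p(F)₄ = 1 and M_a(F)·p(F) = v(F)·𝟙₆, where v(F) = (F·(F+4)/(F+1) + F·(F+4)/(F+2) − 4 − 12(F+4)/(F+12)) / N(F). In particular, for F = 8 one gets p(8) = (10/31, 9/31, 15/62, 9/62) and v(8) = 68/31. -/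
/-- The unnormalized attacker equilibrium vector `n(F)`. -/
noncomputable def nvec (F : ℝ) : Fin 4 → ℝ :=
  ![(F + 4) / (F + 1), (F + 4) / (F + 2), 1, (F + 4) / (F + 12)]

/-- The normalization constant `N(F)`. -/
noncomputable def Nval (F : ℝ) : ℝ :=
  (F + 4) / (F + 1) + (F + 4) / (F + 2) + 1 + (F + 4) / (F + 12)

/-- The attacker equilibrium mixed strategy `p(F) = n(F)/N(F)`. -/
noncomputable def pvec (F : ℝ) : Fin 4 → ℝ := fun j => nvec F j / Nval F

/-- The value `v(F)` of the game. -/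
noncomputable def vval (F : ℝ) : ℝ :=
  (F * (F + 4) / (F + 1) + F * (F + 4) / (F + 2) - 4 - 12 * (F + 4) / (F + 12)) / Nval F

/-- Row by row, `M_a(F)·n(F)` is the constant `v(F)·N(F)`. -/
theorem Ma_mulVec_nvec {F : ℝ} (hF : 0 < F) (i : Fin 6) :
    (Ma F).mulVec (nvec F) i =
      F * (F + 4) / (F + 1) + F * (F + 4) / (F + 2) - 4 - 12 * (F + 4) / (F + 12) := by
  have h1 : F + 1 ≠ 0 := by positivity
  have h2 : F + 2 ≠ 0 := by positivity
  have h12 : F + 12 ≠ 0 := by positivity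
  fin_cases i <;>
    simp [Ma, nvec, Matrix.mulVec, dotProduct, Fin.sum_univ_four] <;>
    field_simp <;> ring

theorem Nval_pos {F : ℝ} (hF : 0 < F) : 0 < Nval F := by
  unfold Nval
  positivity

theorem pvec_eq_smul (F : ℝ) : pvec F = (Nval F)⁻¹ • nvec F := by
  ext j
  simp [pvec, div_eq_inv_mul]

/-- Explicit attacker equilibrium formula: for every fine `F > 0`, the vector
`p(F) = n(F)/N(F)` has entries summing to `1` and satisfies `M_a(F)·p(F) = v(F)·𝟙₆`.
In particular, for `F = 8` one gets `p(8) = (10/31, 9/31, 15/62, 9/62)` and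
`v(8) = 68/31`. -/
theorem attacker_equilibrium_formula :
    (∀ F : ℝ, 0 < F →
      (∑ j, pvec F j = 1) ∧ ∀ i : Fin 6, (Ma F).mulVec (pvec F) i = vval F) ∧
    pvec 8 = ![10 / 31, 9 / 31, 15 / 62, 9 / 62] ∧ vval 8 = 68 / 31 := by
  refine ⟨fun F hF => ⟨?_, fun i => ?_⟩, ?_, ?_⟩
  · have hsum : ∑ j, nvec F j = Nval F := by
      simp [nvec, Nval, Fin.sum_univ_four]
    simp only [pvec]
    rw [← Finset.sum_div, hsum, div_self (Nval_pos hF).ne']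
  · rw [pvec_eq_smul, Matrix.mulVec_smul, Pi.smul_apply, Ma_mulVec_nvec hF, smul_eq_mul,
      vval, inv_mul_eq_div]
  · ext j
    fin_cases j <;> norm_num [pvec, nvec, Nval]
  · norm_num [vval, Nval]
end

section
/- Rank of the defender's payoff matrix: for every fine F > 0, the 6×4 matrix M_a(F) has rank 4 if and only if g(F) ≠ 0, where g(F) = F(F+4)/(F+1) + F(F+4)/(F+2) − 4 − 12(F+4)/(F+12); in particular, M_a(8) has rank 4. -/
/-- `g(F) = F(F+4)/(F+1) + F(F+4)/(F+2) − 4 − 12(F+4)/(F+12)`. -/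
noncomputable def g (F : ℝ) : ℝ :=
  F * (F + 4) / (F + 1) + F * (F + 4) / (F + 2) - 4 - 12 * (F + 4) / (F + 12)

/-- A matrix over a field has full column rank iff its kernel is trivial. -/
theorem rank_eq_card_iff_forall_mulVec {m n K : Type*} [Fintype m] [Fintype n] [Field K]
    (A : Matrix m n K) :
    A.rank = Fintype.card n ↔ ∀ v : n → K, A.mulVec v = 0 → v = 0 := by
  have h := LinearMap.finrank_range_add_finrank_ker A.mulVecLin
  rw [Module.finrank_fintype_fun_eq_card] at h
  have hker : A.rank = Fintype.card n ↔ LinearMap.ker A.mulVecLin = ⊥ := by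
    rw [← Submodule.finrank_eq_zero (R := K), Matrix.rank]
    omega
  rw [hker, LinearMap.ker_eq_bot']
  simp only [Matrix.mulVecLin_apply]

theorem Ma_mulVec_eq_zero_iff (F : ℝ) (v : Fin 4 → ℝ) :
    (Ma F).mulVec v = 0 ↔
      (F + 1) * v 0 = (F + 4) * v 2 ∧ (F + 2) * v 1 = (F + 4) * v 2 ∧
        (F + 12) * v 3 = (F + 4) * v 2 ∧ F * v 0 + F * v 1 - 4 * v 2 - 12 * v 3 = 0 := by
  rw [funext_iff]
  simp only [Ma, Matrix.mulVec, dotProduct, Fin.forall_fin_succ, Fin.sum_univ_succ]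
  simp
  constructor
  · rintro ⟨h0, h1, h2, h3, h4, h5⟩
    refine ⟨?_, ?_, ?_, ?_⟩ <;> linarith
  · rintro ⟨h0, h1, h2, h3⟩
    refine ⟨?_, ?_, ?_, ?_, ?_, ?_⟩ <;> linarith

theorem rank_Ma_eq_four_iff {F : ℝ} (hF : 0 < F) : (Ma F).rank = 4 ↔ g F ≠ 0 := by
  have h1 : F + 1 ≠ 0 := by positivity
  have h2 : F + 2 ≠ 0 := by positivity
  have h12 : F + 12 ≠ 0 := by positivity
  have hrank := rank_eq_card_iff_forall_mulVec (Ma F)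
  rw [Fintype.card_fin] at hrank
  rw [hrank]
  simp only [Ma_mulVec_eq_zero_iff]
  constructor
  · intro h hg
    have hv := h ![(F + 4) / (F + 1), (F + 4) / (F + 2), 1, (F + 4) / (F + 12)] (by
      refine ⟨?_, ?_, ?_, ?_⟩
      · simp; field_simp
      · simp; field_simp
      · simp; field_simp
      · rw [← hg]
        simp [g]
        ring)
    simpa using congrFun hv 2
  · rintro hg v ⟨hA, hB, hD, hsum⟩
    have eA : v 0 = (F + 4) / (F + 1) * v 2 := by field_simp; linarith
    have eB : v 1 = (F + 4) / (F + 2) * v 2 := by field_simp; linarith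
    have eD : v 3 = (F + 4) / (F + 12) * v 2 := by field_simp; linarith
    have hmul : g F * v 2 = 0 := by
      rw [← hsum, eA, eB, eD, g]
      ring
    have hC : v 2 = 0 := (mul_eq_zero.mp hmul).resolve_left hg
    ext i
    fin_cases i <;> simp [eA, eB, eD, hC]

/-- Rank of the defender's payoff matrix: for every fine `F > 0`, the `6 × 4` matrix
`M_a(F)` has rank `4` if and only if `g(F) ≠ 0`; in particular `M_a(8)` has rank `4`. -/
theorem rank_Ma :
    (∀ F : ℝ, 0 < F → ((Ma F).rank = 4 ↔ g F ≠ 0)) ∧ (Ma 8).rank = 4 := by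
  exact ⟨fun F hF => rank_Ma_eq_four_iff hF,
    (rank_Ma_eq_four_iff (by norm_num)).mpr (by norm_num [g])⟩
end

section
/- Characterization of the defender's equilibrium set at F = 8 (equation (16) of the paper, in exact fractions): let x = (x₁, …, x₆) ∈ ℝ⁶ with x₁ + ⋯ + x₆ = 1, where the coordinates correspond to the defender strategies (AB, AC, AD, BC, BD, CD). Then all four entries of M_d(8)·x are equal (the attacker is indifferent among A, B, C, D) if and only if x₁ = x₆ − 7/31, x₂ = x₅ − 4/31, x₃ = 22/31 − x₅ − x₆, and x₄ = 20/31 − x₅ − x₆; in that case each entry of M_d(8)·x equals −68/31. -/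
/-- The attacker's payoffs against a mixed defender strategy `x`, written out. -/
theorem Md_mulVec (F : ℝ) (x : Fin 6 → ℝ) :
    (Md F).mulVec x =
      ![-F * (x 0 + x 1 + x 2) + (x 3 + x 4 + x 5),
        -F * (x 0 + x 3 + x 4) + 2 * (x 1 + x 2 + x 5),
        -F * (x 1 + x 3 + x 5) + 4 * (x 0 + x 2 + x 4),
        -F * (x 2 + x 4 + x 5) + 12 * (x 0 + x 1 + x 3)] := by
  ext i
  fin_cases i <;>
    simp [Md, Ma, Matrix.mulVec, dotProduct, Fin.sum_univ_six] <;> ring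

/-- Characterization of the defender's equilibrium set at `F = 8` (equation (16) of the
paper, in exact fractions): for `x ∈ ℝ⁶` with `x₁ + ⋯ + x₆ = 1` (coordinates ordered as
`AB, AC, AD, BC, BD, CD`), all four entries of `M_d(8)·x` are equal (the attacker is
indifferent among `A, B, C, D`) if and only if `x₁ = x₆ − 7/31`, `x₂ = x₅ − 4/31`,
`x₃ = 22/31 − x₅ − x₆`, and `x₄ = 20/31 − x₅ − x₆`; in that case each entry of
`M_d(8)·x` equals `−68/31`. -/
theorem defender_equilibrium_set (x : Fin 6 → ℝ) (hsum : ∑ i, x i = 1) :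
    ((∀ i j : Fin 4, (Md 8).mulVec x i = (Md 8).mulVec x j) ↔
      (x 0 = x 5 - 7 / 31 ∧ x 1 = x 4 - 4 / 31 ∧
       x 2 = 22 / 31 - x 4 - x 5 ∧ x 3 = 20 / 31 - x 4 - x 5)) ∧
    ((x 0 = x 5 - 7 / 31 ∧ x 1 = x 4 - 4 / 31 ∧
      x 2 = 22 / 31 - x 4 - x 5 ∧ x 3 = 20 / 31 - x 4 - x 5) →
      ∀ i : Fin 4, (Md 8).mulVec x i = -(68 / 31)) := by
  rw [Fin.sum_univ_six] at hsum
  have value : (x 0 = x 5 - 7 / 31 ∧ x 1 = x 4 - 4 / 31 ∧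
      x 2 = 22 / 31 - x 4 - x 5 ∧ x 3 = 20 / 31 - x 4 - x 5) →
      ∀ i : Fin 4, (Md 8).mulVec x i = -(68 / 31) := by
    rintro ⟨h0, h1, h2, h3⟩ i
    rw [Md_mulVec, h0, h1, h2, h3]
    fin_cases i <;> simp <;> ring
  refine ⟨⟨fun h => ?_, fun h i j => (value h i).trans (value h j).symm⟩, value⟩
  have hAB := h 0 1
  have hAC := h 0 2
  have hAD := h 0 3
  simp only [Md_mulVec, Matrix.cons_val] at hAB hAC hAD
  refine ⟨?_, ?_, ?_, ?_⟩ <;> linarith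
end

section
/- Theorem 2, multiplicity of equilibria at F = 8: the two distinct defender mixed strategies q = (0, 0, 11/31, 9/31, 4/31, 7/31) and q' = (0, 6/31, 5/31, 3/31, 10/31, 7/31) (coordinates ordered as AB, AC, AD, BC, BD, CD) are both nonnegative with entries summing to 1 and both satisfy M_d(8)·q = M_d(8)·q' = (−68/31)·𝟙₄. Moreover, with p* = (10/31, 9/31, 15/62, 9/62), each of the pairs (q, p*) and (q', p*) is a mixed-strategy Nash equilibrium of the F = 8 game: qᵀ M_a(8) p* ≥ rᵀ M_a(8) p* for every defender mixed strategy r, and −qᵀ M_a(8) p* ≥ −qᵀ M_a(8) s for every attacker mixed strategy s (and likewise for q'). Hence the game admits multiple mixed-strategy Nash equilibria. -/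
open Matrix

/-- The defender equilibrium strategy `q = (0, 0, 11/31, 9/31, 4/31, 7/31)`. -/
noncomputable def qeq : Fin 6 → ℝ := ![0, 0, 11 / 31, 9 / 31, 4 / 31, 7 / 31]

/-- The defender equilibrium strategy `q' = (0, 6/31, 5/31, 3/31, 10/31, 7/31)`. -/
noncomputable def qeq' : Fin 6 → ℝ := ![0, 6 / 31, 5 / 31, 3 / 31, 10 / 31, 7 / 31]

/-- The attacker equilibrium strategy `p* = (10/31, 9/31, 15/62, 9/62)`. -/
noncomputable def pstar : Fin 4 → ℝ := ![10 / 31, 9 / 31, 15 / 62, 9 / 62]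

/-- Against `p*`, every pure strategy of the defender earns `68/31`. -/
lemma Ma_mulVec_pstar : (Ma 8).mulVec pstar = fun _ => 68 / 31 := by
  funext i
  fin_cases i <;> norm_num [Ma, pstar, mulVec, dotProduct, Fin.sum_univ_succ]

lemma Md_mulVec_qeq (i : Fin 4) : (Md 8).mulVec qeq i = -(68 / 31) := by
  fin_cases i <;> norm_num [Md, Ma, qeq, mulVec, dotProduct, Fin.sum_univ_succ]

lemma Md_mulVec_qeq' (i : Fin 4) : (Md 8).mulVec qeq' i = -(68 / 31) := by
  fin_cases i <;> norm_num [Md, Ma, qeq', mulVec, dotProduct, Fin.sum_univ_succ]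

lemma dotProduct_const_of_sum_eq_one {ι : Type*} [Fintype ι] {r : ι → ℝ}
    (hr : ∑ i, r i = 1) (c : ℝ) : r ⬝ᵥ (fun _ => c) = c := by
  rw [dotProduct, ← Finset.sum_mul, hr, one_mul]

lemma dotProduct_Ma_mulVec_pstar {r : Fin 6 → ℝ} (hr : ∑ i, r i = 1) :
    r ⬝ᵥ (Ma 8).mulVec pstar = 68 / 31 := by
  rw [Ma_mulVec_pstar, dotProduct_const_of_sum_eq_one hr]

/-- A defender strategy equalizing the attacker's payoffs guarantees the same value against
every mixed strategy of the attacker. -/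
lemma dotProduct_Ma_mulVec_of_Md_mulVec_eq {F v : ℝ} {q : Fin 6 → ℝ} {s : Fin 4 → ℝ}
    (hq : ∀ i, (Md F).mulVec q i = -v) (hs : ∑ j, s j = 1) :
    q ⬝ᵥ (Ma F).mulVec s = v := by
  have h : q ᵥ* Ma F = fun _ => v := by
    funext i
    have hi := hq i
    rw [Md, neg_mulVec, Pi.neg_apply, mulVec_transpose] at hi
    exact neg_injective hi
  rw [dotProduct_mulVec, h, dotProduct_comm, dotProduct_const_of_sum_eq_one hs]

/-- Theorem 2, multiplicity of equilibria at `F = 8`: the two distinct defender mixed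
strategies `q` and `q'` are both nonnegative with entries summing to `1` and both
satisfy `M_d(8)·q = M_d(8)·q' = (−68/31)·𝟙₄`. Moreover, with
`p* = (10/31, 9/31, 15/62, 9/62)`, each of the pairs `(q, p*)` and `(q', p*)` is a
mixed-strategy Nash equilibrium of the `F = 8` game. Hence the game admits multiple
mixed-strategy Nash equilibria. -/
theorem multiple_equilibria_F8 :
    qeq ≠ qeq' ∧
    (∀ i, 0 ≤ qeq i) ∧ (∑ i, qeq i = 1) ∧
    (∀ i, 0 ≤ qeq' i) ∧ (∑ i, qeq' i = 1) ∧
    (∀ i : Fin 4, (Md 8).mulVec qeq i = -(68 / 31)) ∧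
    (∀ i : Fin 4, (Md 8).mulVec qeq' i = -(68 / 31)) ∧
    (∀ r : Fin 6 → ℝ, (∀ i, 0 ≤ r i) → (∑ i, r i = 1) →
      r ⬝ᵥ (Ma 8).mulVec pstar ≤ qeq ⬝ᵥ (Ma 8).mulVec pstar) ∧
    (∀ s : Fin 4 → ℝ, (∀ j, 0 ≤ s j) → (∑ j, s j = 1) →
      -(qeq ⬝ᵥ (Ma 8).mulVec s) ≤ -(qeq ⬝ᵥ (Ma 8).mulVec pstar)) ∧
    (∀ r : Fin 6 → ℝ, (∀ i, 0 ≤ r i) → (∑ i, r i = 1) →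
      r ⬝ᵥ (Ma 8).mulVec pstar ≤ qeq' ⬝ᵥ (Ma 8).mulVec pstar) ∧
    (∀ s : Fin 4 → ℝ, (∀ j, 0 ≤ s j) → (∑ j, s j = 1) →
      -(qeq' ⬝ᵥ (Ma 8).mulVec s) ≤ -(qeq' ⬝ᵥ (Ma 8).mulVec pstar)) := by
  have hq : ∑ i, qeq i = 1 := by norm_num [qeq, Fin.sum_univ_succ]
  have hq' : ∑ i, qeq' i = 1 := by norm_num [qeq', Fin.sum_univ_succ]
  refine ⟨fun h => ?_, fun i => ?_, hq, fun i => ?_, hq', Md_mulVec_qeq, Md_mulVec_qeq',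
    fun r _ hr => ?_, fun s _ hs => ?_, fun r _ hr => ?_, fun s _ hs => ?_⟩
  · have h1 := congrFun h 1
    norm_num [qeq, qeq'] at h1
  · fin_cases i <;> norm_num [qeq]
  · fin_cases i <;> norm_num [qeq']
  · rw [dotProduct_Ma_mulVec_pstar hr, dotProduct_Ma_mulVec_pstar hq]
  · rw [dotProduct_Ma_mulVec_of_Md_mulVec_eq Md_mulVec_qeq hs, dotProduct_Ma_mulVec_pstar hq]
  · rw [dotProduct_Ma_mulVec_pstar hr, dotProduct_Ma_mulVec_pstar hq']
  · rw [dotProduct_Ma_mulVec_of_Md_mulVec_eq Md_mulVec_qeq' hs, dotProduct_Ma_mulVec_pstar hq']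
end

section
/- Theorem 2, uniqueness of the attacker's equilibrium strategy at F = 8: if (q, p) is any mixed-strategy Nash equilibrium of the F = 8 game — i.e., q is a defender mixed strategy, p is an attacker mixed strategy, qᵀ M_a(8) p ≥ rᵀ M_a(8) p for every defender mixed strategy r, and −qᵀ M_a(8) p ≥ −qᵀ M_a(8) s for every attacker mixed strategy s — then p = (10/31, 9/31, 15/62, 9/62). In particular, the attacker's mixed strategy is the same in all mixed-strategy Nash equilibria. -/
open Matrix

/-- Theorem 2, uniqueness of the attacker's equilibrium strategy at `F = 8`: if
`(q, p)` is any mixed-strategy Nash equilibrium of the `F = 8` game — `q` a defender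
mixed strategy, `p` an attacker mixed strategy, `qᵀ M_a(8) p ≥ rᵀ M_a(8) p` for every
defender mixed strategy `r`, and `−qᵀ M_a(8) p ≥ −qᵀ M_a(8) s` for every attacker
mixed strategy `s` — then `p = (10/31, 9/31, 15/62, 9/62)`. In particular, the
attacker's mixed strategy is the same in all mixed-strategy Nash equilibria. -/
theorem attacker_strategy_unique_F8 (q : Fin 6 → ℝ) (p : Fin 4 → ℝ)
    (hq0 : ∀ i, 0 ≤ q i) (hq1 : ∑ i, q i = 1)
    (hp0 : ∀ j, 0 ≤ p j) (hp1 : ∑ j, p j = 1)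
    (hdef : ∀ r : Fin 6 → ℝ, (∀ i, 0 ≤ r i) → (∑ i, r i = 1) →
      r ⬝ᵥ (Ma 8).mulVec p ≤ q ⬝ᵥ (Ma 8).mulVec p)
    (hatt : ∀ s : Fin 4 → ℝ, (∀ j, 0 ≤ s j) → (∑ j, s j = 1) →
      -(q ⬝ᵥ (Ma 8).mulVec s) ≤ -(q ⬝ᵥ (Ma 8).mulVec p)) :
    p = ![10 / 31, 9 / 31, 15 / 62, 9 / 62] := by
  have hrow (i : Fin 6) : (Ma 8).mulVec p i ≤ q ⬝ᵥ (Ma 8).mulVec p := by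
    simpa using hdef (Pi.single i 1) (fun j => by by_cases h : j = i <;> simp [h])
      (by simp)
  have hequal : (Ma 8).mulVec ![10 / 31, 9 / 31, 15 / 62, 9 / 62] = fun _ => 68 / 31 := by
    ext i
    fin_cases i <;> norm_num [Ma, mulVec, dotProduct, Fin.sum_univ_succ]
  have hvalue : q ⬝ᵥ (Ma 8).mulVec p ≤ 68 / 31 := by
    have h := hatt ![10 / 31, 9 / 31, 15 / 62, 9 / 62]
      (fun j => by fin_cases j <;> norm_num) (by norm_num [Fin.sum_univ_succ])
    rw [hequal] at h
    have hconst : q ⬝ᵥ (fun _ => (68 / 31 : ℝ)) = 68 / 31 := by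
      simp only [dotProduct, ← Finset.sum_mul, hq1, one_mul]
    linarith
  have hle (i : Fin 6) : (Ma 8).mulVec p i ≤ 68 / 31 := (hrow i).trans hvalue
  have h0 := hle 0
  have h1 := hle 1
  have h2 := hle 2
  have h3 := hle 3
  have h4 := hle 4
  have h5 := hle 5
  simp [Ma, mulVec, dotProduct, Fin.sum_univ_four] at h0 h1 h2 h3 h4 h5
  rw [Fin.sum_univ_four] at hp1
  ext j
  fin_cases j <;> simp <;> linarith
end

section
/- Theorem 3 (EUT case): there exists a fine value F^v with 3 < F^v < 3.1 and an attacker mixed strategy p (a nonnegative vector in ℝ⁴ with entries summing to 1) such that M_a(F^v)·p = 0 ∈ ℝ⁶; that is, at the fine F^v the value of the zero-sum game is zero, so at equilibrium neither the attacker nor the defender wins. -/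
/-- The quartic whose root is the zero-value fine: it is the numerator of
`∑ t, F / (F + V_t) = 2` for the damages `V = (1, 2, 4, 12)`. -/
theorem exists_root_fine_quartic :
    ∃ F : ℝ, 3 < F ∧ F < 3.1 ∧ 2 * F ^ 4 + 19 * F ^ 3 - 176 * F - 192 = 0 := by
  have hc : ContinuousOn (fun F : ℝ => 2 * F ^ 4 + 19 * F ^ 3 - 176 * F - 192)
      (Set.Icc 3 3.1) := by fun_prop
  obtain ⟨F, ⟨h3, h31⟩, hF⟩ := intermediate_value_Ioo (by norm_num) hc
    (show (0 : ℝ) ∈ Set.Ioo _ _ by constructor <;> norm_num)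
  exact ⟨F, h3, h31, hF⟩

/-- Theorem 3 (EUT case): there exists a fine value `F^v` with `3 < F^v < 3.1` and an
attacker mixed strategy `p` (a nonnegative vector in `ℝ⁴` with entries summing to `1`)
such that `M_a(F^v)·p = 0 ∈ ℝ⁶`; that is, at the fine `F^v` the value of the zero-sum
game is zero, so at equilibrium neither the attacker nor the defender wins. -/
theorem exists_fine_zero_value :
    ∃ Fv : ℝ, 3 < Fv ∧ Fv < 3.1 ∧
      ∃ p : Fin 4 → ℝ, (∀ j, 0 ≤ p j) ∧ (∑ j, p j = 1) ∧
        (Ma Fv).mulVec p = 0 := by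
  obtain ⟨F, h3, h31, hF⟩ := exists_root_fine_quartic
  have h0 : 0 < F := by linarith
  have hA : F + 1 ≠ 0 := by positivity
  have hB : F + 2 ≠ 0 := by positivity
  have hC : F + 4 ≠ 0 := by positivity
  have hD : F + 12 ≠ 0 := by positivity
  -- The attacker is indifferent between tested pairs when `p t` is proportional to `1 / (F + V_t)`.
  refine ⟨F, h3, h31,
    ![F / (2 * (F + 1)), F / (2 * (F + 2)), F / (2 * (F + 4)), F / (2 * (F + 12))], ?_, ?_, ?_⟩
  · intro j
    fin_cases j <;> simp <;> positivity
  · simp only [Fin.sum_univ_four, Matrix.cons_val]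
    field_simp
    linear_combination hF
  · ext i
    fin_cases i <;>
      simp [Ma, Matrix.mulVec, dotProduct, Fin.sum_univ_four] <;>
      field_simp <;>
      linear_combination F * hF
end

section
/- Corollary 1 (EUT case): there exists a fine threshold F_min > 0 such that for every fine F with 0 < F < F_min, any pair (p, v) ∈ ℝ⁴ × ℝ with p a nonnegative vector whose entries sum to 1 and M_a(F)·p = v·𝟙₆ satisfies v < 0; that is, for sufficiently small fines the equilibrium value of the game is negative for the defender, so the attacker wins overall (U_a = −v > 0 and U_d = v < 0). -/
/-- Corollary 1 (EUT case): there exists a fine threshold `F_min > 0` such that for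
every fine `F` with `0 < F < F_min`, any pair `(p, v)` with `p` a nonnegative vector in
`ℝ⁴` whose entries sum to `1` and `M_a(F)·p = v·𝟙₆` satisfies `v < 0`; that is, for
sufficiently small fines the equilibrium value of the game is negative for the
defender, so the attacker wins overall (`U_a = −v > 0` and `U_d = v < 0`). -/
theorem attacker_wins_for_small_fines :
    ∃ Fmin : ℝ, 0 < Fmin ∧
      ∀ F : ℝ, 0 < F → F < Fmin →
        ∀ (p : Fin 4 → ℝ) (v : ℝ), (∀ j, 0 ≤ p j) → (∑ j, p j = 1) →
          (∀ i : Fin 6, (Ma F).mulVec p i = v) → v < 0 := by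
  refine ⟨1, one_pos, fun F _ hF p v hp hsum hv => ?_⟩
  -- Averaging the six indifference equations, `2 * v = ∑ t, p t * (F - V_t) ≤ F - 1`.
  have h₀ := hv 0
  have h₁ := hv 1
  have h₂ := hv 2
  have h₃ := hv 3
  have h₄ := hv 4
  have h₅ := hv 5
  simp [Ma, Matrix.mulVec, dotProduct, Fin.sum_univ_four] at h₀ h₁ h₂ h₃ h₄ h₅
  rw [Fin.sum_univ_four] at hsum
  have hF_sum : F * p 0 + F * p 1 + F * p 2 + F * p 3 = F := by
    linear_combination F * hsum
  linarith [hp 1, hp 2, hp 3]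
end
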